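/- Let H be a finite tree on vertex set ι (a connected acyclic finite simple graph). For every i ∈ ι let G_i be a connected finite simple graph with property (P) on vertex set V_i, and for every i let a_i be an arbitrary attachment function assigning to each neighbor j of i in H a vertex a_i(j) ∈ V_i. Then the generalized threaded union of the family {G_i} over H with attachment functions {a_i} has property (P), for every choice of attachment functions. -/

import Mathlib

open Matrix SimpleGraph

/-- A finite simple graph `G` has property (P) if there is a real symmetric matrix `A`
whose off-diagonal support is exactly the edge set of `G`, with `det A ≠ 0`, and such that
every principal submatrix obtained by deleting one row/column is singular. -/
def HasPropertyP {V : Type*} [Finite V] (G : SimpleGraph V) : Prop :=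
  letI : Fintype V := Fintype.ofFinite V
  letI : DecidableEq V := Classical.decEq V
  ∃ A : Matrix V V ℝ, A.IsSymm ∧
    (∀ u v : V, u ≠ v → (A u v ≠ 0 ↔ G.Adj u v)) ∧
    A.det ≠ 0 ∧
    ∀ v : V,
      (A.submatrix (fun x : {x : V // x ≠ v} => (x : V))
        (fun x : {x : V // x ≠ v} => (x : V))).det = 0


/-- The generalized threaded union of the family of graphs `G i` over `H`, with
attachment functions `a i : ι → V i`: vertices `⟨i, x⟩` and `⟨j, y⟩` are adjacent iff
either `i = j` and `x, y` are adjacent in `G i`, or `i ≠ j`, `i` and `j` are adjacent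
in `H`, `x = a i j` and `y = a j i`. -/
def genThreadedUnion {ι : Type*} (H : SimpleGraph ι) {V : ι → Type*}
    (G : ∀ i, SimpleGraph (V i)) (a : ∀ i, ι → V i) : SimpleGraph (Σ i, V i) :=
  SimpleGraph.fromRel fun x y =>
    (∃ (i : ι) (u v : V i), (G i).Adj u v ∧ x = ⟨i, u⟩ ∧ y = ⟨i, v⟩) ∨
    (x.1 ≠ y.1 ∧ H.Adj x.1 y.1 ∧ x.2 = a x.1 y.1 ∧ y.2 = a y.1 x.1)

lemma adjugate_diag_eq {V : Type*} [Fintype V] [DecidableEq V] (A : Matrix V V ℝ) (v : V) :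
    A.adjugate v v = (A.submatrix (fun x : {x : V // x ≠ v} => (x : V))
        (fun x : {x : V // x ≠ v} => (x : V))).det := by
  rw [adjugate_apply, twoBlockTriangular_det _ (fun x => x ≠ v)]
  · have h1 : (toSquareBlockProp (A.updateRow v (Pi.single v 1)) (fun x => x ≠ v)) =
        (A.submatrix (fun x : {x : V // x ≠ v} => (x : V))
        (fun x : {x : V // x ≠ v} => (x : V))) := by
      ext x y
      simp [toSquareBlockProp, updateRow_apply, x.2]
    have h2 : (toSquareBlockProp (A.updateRow v (Pi.single v 1)) (fun x => ¬ (x ≠ v))) = 1 := by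
      ext x y
      obtain ⟨x, hx⟩ := x
      obtain ⟨y, hy⟩ := y
      have hx' : x = v := not_not.mp hx
      have hy' : y = v := not_not.mp hy
      subst hx'
      subst hy'
      simp [toSquareBlockProp]
    rw [h1, h2, det_one, mul_one]
  · intro i hi j hj
    have : i = v := not_not.mp hi
    subst this
    simp [hj]

lemma minor_zero_iff {V : Type*} [Fintype V] [DecidableEq V] (A B : Matrix V V ℝ)
    (h : A * B = 1) (v : V) :
    (A.submatrix (fun x : {x : V // x ≠ v} => (x : V))
        (fun x : {x : V // x ≠ v} => (x : V))).det = 0 ↔ B v v = 0 := by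
  have hB : A.adjugate = A.det • B := by
    calc A.adjugate = A.adjugate * (A * B) := by rw [h, mul_one]
      _ = A.det • B := by rw [← mul_assoc, adjugate_mul, smul_mul_assoc, one_mul]
  have hd : A.det ≠ 0 := by
    intro h0
    have := congrArg det h
    rw [det_mul, h0, det_one, zero_mul] at this
    exact zero_ne_one this
  rw [← adjugate_diag_eq, hB]
  simp [hd]

lemma hasPropertyP_iff {V : Type*} [Finite V] [iF : Fintype V] [iD : DecidableEq V] (G : SimpleGraph V) :
    HasPropertyP G ↔ ∃ A B : Matrix V V ℝ, A.IsSymm ∧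
      (∀ u v : V, u ≠ v → (A u v ≠ 0 ↔ G.Adj u v)) ∧ A * B = 1 ∧ ∀ v, B v v = 0 := by
  have e1 : iF = Fintype.ofFinite V := Subsingleton.elim _ _
  have e2 : iD = Classical.decEq V := Subsingleton.elim _ _
  subst e1
  subst e2
  letI : Fintype V := Fintype.ofFinite V
  letI : DecidableEq V := Classical.decEq V
  constructor
  · rintro ⟨A, hs, hA, hd, hm⟩
    have hi : A * A⁻¹ = 1 := A.mul_nonsing_inv hd.isUnit
    exact ⟨A, A⁻¹, hs, hA, hi, fun v => (minor_zero_iff A _ hi v).1 (hm v)⟩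
  · rintro ⟨A, B, hs, hA, hi, hB⟩
    refine ⟨A, hs, hA, ?_, fun v => (minor_zero_iff A B hi v).2 (hB v)⟩
    intro h0
    have := congrArg det hi
    rw [det_mul, h0, det_one, zero_mul] at this
    exact zero_ne_one this

open Classical in
/-- The matrix of connecting edges. -/
noncomputable def threadMat {ι : Type*} {V : ι → Type*} (a : ∀ i, ι → V i) (H : SimpleGraph ι) :
    Matrix (Σ i, V i) (Σ i, V i) ℝ :=
  fun p q => if H.Adj p.1 q.1 ∧ p.2 = a p.1 q.1 ∧ q.2 = a q.1 p.1 then 1 else 0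

/-- One step: adding an edge. -/
lemma edge_step {W : Type*} [Fintype W] [DecidableEq W] (A B : Matrix W W ℝ) (h : A * B = 1)
    (u w : W) (huu : B u u = 0) (hww : B w w = 0) (huw : B u w = 0) (hwu : B w u = 0) :
    (A + (single u w 1 + single w u 1)) *
      (B - B * (single u w 1 + single w u 1) * B) = 1 := by
  set E : Matrix W W ℝ := single u w 1 + single w u 1 with hE
  have hEBE : E * B * E = 0 := by
    rw [hE]
    simp [add_mul, mul_add, huu, hww, huw, hwu]
  calc (A + E) * (B - B * E * B)
      = A * B + E * B - (A * B) * (E * B) - (E * B * E) * B := by noncomm_ring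
    _ = 1 := by rw [hEBE, h]; simp

lemma BEB_apply {W : Type*} [Fintype W] [DecidableEq W] (B : Matrix W W ℝ) (u w p q : W) :
    (B * (single u w 1 + single w u 1) * B : Matrix W W ℝ) p q = B p u * B w q + B p w * B u q := by
  have key : ∀ s t : W, (B * single s t (1:ℝ) * B : Matrix W W ℝ) p q = B p s * B t q := by
    intro s t
    rw [Matrix.mul_apply, Finset.sum_eq_single t]
    · simp
    · intro x _ hx
      rw [mul_single_apply_of_ne (hbj := hx), zero_mul]
    · simp
  rw [mul_add, add_mul, Matrix.add_apply, key, key]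

lemma thread_main {ι : Type*} [Fintype ι] [DecidableEq ι] {V : ι → Type*}
    [∀ i, Fintype (V i)] [∀ i, DecidableEq (V i)] (a : ∀ i, ι → V i)
    (M N : ∀ i, Matrix (V i) (V i) ℝ) (hMN : ∀ i, M i * N i = 1) (hN : ∀ i v, N i v v = 0)
    (H : SimpleGraph ι) : H.IsAcyclic →
    ∃ B : Matrix (Σ i, V i) (Σ i, V i) ℝ, (blockDiagonal' M + threadMat a H) * B = 1 ∧
      (∀ p, B p p = 0) ∧ ∀ p q, B p q ≠ 0 → H.Reachable p.1 q.1 := by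
  induction H using WellFoundedLT.induction with
  | ind H ih =>
  intro hH
  by_cases hbot : H = ⊥
  · subst hbot
    refine ⟨blockDiagonal' N, ?_, ?_, ?_⟩
    · have : threadMat a (⊥ : SimpleGraph ι) = 0 := by
        ext p q
        simp [threadMat]
      rw [this, add_zero, ← blockDiagonal'_mul]
      simp only [hMN]
      exact blockDiagonal'_one
    · rintro ⟨i, v⟩
      simp [hN]
    · rintro ⟨i, v⟩ ⟨j, w⟩ h
      by_cases hij : i = j
      · subst hij; rfl
      · exact absurd (blockDiagonal'_apply_ne _ _ _ hij) h
  · obtain ⟨i, j, hij⟩ := SimpleGraph.ne_bot_iff_exists_adj.1 hbot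
    have hle : H.deleteEdges {s(i, j)} ≤ H := deleteEdges_le _
    have hbr : ¬ (H.deleteEdges {s(i, j)}).Reachable i j := by
      have := (isAcyclic_iff_forall_adj_isBridge.1 hH) hij
      rw [isBridge_iff] at this
      simpa using this
    have hlt : H.deleteEdges {s(i, j)} < H := by
      refine lt_of_le_of_ne hle ?_
      intro h
      rw [h] at hbr
      exact hbr hij.reachable
    obtain ⟨B, hB1, hB2, hB3⟩ := ih _ hlt (hH.anti hle)
    have hne : i ≠ j := hij.ne
    set u : Σ i, V i := ⟨i, a i j⟩ with hu
    set w : Σ i, V i := ⟨j, a j i⟩ with hw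
    have huw : B u w = 0 := by
      by_contra h
      exact hbr (hB3 _ _ h)
    have hwu : B w u = 0 := by
      by_contra h
      exact hbr (hB3 _ _ h).symm
    have hT : threadMat a H = threadMat a (H.deleteEdges {s(i, j)}) +
        (single u w 1 + single w u 1) := by
      ext ⟨k, x⟩ ⟨l, y⟩
      by_cases h1 : k = i ∧ l = j
      · obtain ⟨rfl, rfl⟩ := h1
        simp [threadMat, hu, hw, single_apply, hij, hne, hne.symm, eq_comm]
      · by_cases h2 : k = j ∧ l = i
        · obtain ⟨rfl, rfl⟩ := h2
          simp [threadMat, hu, hw, single_apply, hij.symm, hne, hne.symm, eq_comm]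
        · have e1 : ¬ (u = ⟨k, x⟩ ∧ w = ⟨l, y⟩) := by
            rintro ⟨h, h'⟩
            exact h1 ⟨(congrArg Sigma.fst h).symm, (congrArg Sigma.fst h').symm⟩
          have e2 : ¬ (w = ⟨k, x⟩ ∧ u = ⟨l, y⟩) := by
            rintro ⟨h, h'⟩
            exact h2 ⟨(congrArg Sigma.fst h).symm, (congrArg Sigma.fst h').symm⟩
          have e3 : (H.deleteEdges {s(i, j)}).Adj k l ↔ H.Adj k l := by
            simp only [deleteEdges_adj, Set.mem_singleton_iff, Sym2.eq_iff]
            tauto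
          simp only [threadMat, Matrix.add_apply, single_apply, e1, e2, if_false, add_zero]
          congr 1
          rw [e3]
    refine ⟨B - B * (single u w 1 + single w u 1) * B, ?_, ?_, ?_⟩
    · rw [hT, ← add_assoc]
      exact edge_step _ _ hB1 u w (hB2 u) (hB2 w) huw hwu
    · intro p
      rw [Matrix.sub_apply, BEB_apply, hB2]
      have z1 : B p u * B w p = 0 := by
        by_contra h
        exact hbr ((hB3 _ _ (right_ne_zero_of_mul h)).trans
          (hB3 _ _ (left_ne_zero_of_mul h))).symm
      have z2 : B p w * B u p = 0 := by
        by_contra h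
        exact hbr ((hB3 _ _ (right_ne_zero_of_mul h)).trans
          (hB3 _ _ (left_ne_zero_of_mul h)))
      rw [z1, z2]; simp
    · intro p q h
      rw [Matrix.sub_apply, BEB_apply] at h
      by_contra hr
      have hm : ∀ s t, B s t ≠ 0 → H.Reachable s.1 t.1 := fun s t h => (hB3 s t h).mono hle
      have z0 : B p q = 0 := by
        by_contra h
        exact hr (hm _ _ h)
      have z1 : B p u * B w q = 0 := by
        by_contra h
        exact hr (((hm _ _ (left_ne_zero_of_mul h)).trans hij.reachable).trans
          (hm _ _ (right_ne_zero_of_mul h)))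
      have z2 : B p w * B u q = 0 := by
        by_contra h
        exact hr (((hm _ _ (left_ne_zero_of_mul h)).trans hij.symm.reachable).trans
          (hm _ _ (right_ne_zero_of_mul h)))
      rw [z0, z1, z2] at h
      simp at h

/-- If `H` is a finite tree and each `G i` is a connected graph with property (P), then
the generalized threaded union of the `G i` over `H` has property (P), for every choice
of attachment functions. -/
theorem stmt_18 {ι : Type*} [Finite ι] (H : SimpleGraph ι) (htree : H.IsTree)
    {V : ι → Type*} [∀ i, Finite (V i)] (G : ∀ i, SimpleGraph (V i))
    (hGconn : ∀ i, (G i).Connected) (hGP : ∀ i, HasPropertyP (G i))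
    (a : ∀ i, ι → V i) :
    HasPropertyP (genThreadedUnion H G a) := by
  classical
  letI : Fintype ι := Fintype.ofFinite ι
  letI : ∀ i, Fintype (V i) := fun i => Fintype.ofFinite (V i)
  have h := fun i => (hasPropertyP_iff (G i)).1 (hGP i)
  choose M N hs hM hMN hN using h
  obtain ⟨B, hB1, hB2, -⟩ := thread_main a M N hMN hN H htree.isAcyclic
  refine (hasPropertyP_iff _).2 ⟨_, B, ?_, ?_, hB1, hB2⟩
  · refine IsSymm.add ?_ ?_
    · rw [IsSymm, blockDiagonal'_transpose]
      simp only [fun i => (hs i).eq]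
    · ext p q
      simp only [threadMat, transpose_apply, H.adj_comm q.1 p.1]
      congr 1
      simp only [eq_iff_iff]
      tauto
  · rintro ⟨i, x⟩ ⟨j, y⟩ hne
    by_cases hij : i = j
    · subst hij
      have hxy : x ≠ y := fun h => hne (by rw [h])
      have h0 : threadMat a H ⟨i, x⟩ ⟨i, y⟩ = 0 := by simp [threadMat]
      rw [Matrix.add_apply, h0, add_zero, blockDiagonal'_apply_eq, hM i x y hxy]
      simp only [genThreadedUnion, fromRel_adj]
      constructor
      · intro h
        exact ⟨hne, Or.inl (Or.inl ⟨i, x, y, h, rfl, rfl⟩)⟩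
      · rintro ⟨-, (⟨k, s, t, h, h1, h2⟩ | h) | (⟨k, s, t, h, h1, h2⟩ | h)⟩
        · cases h1; cases h2; exact h
        · exact absurd rfl h.1
        · cases h1; cases h2; exact h.symm
        · exact absurd rfl h.1
    · rw [Matrix.add_apply, blockDiagonal'_apply_ne _ _ _ hij, zero_add]
      simp only [genThreadedUnion, fromRel_adj, threadMat]
      constructor
      · intro h
        have h' := (ite_ne_right_iff.1 h).1
        exact ⟨hne, Or.inl (Or.inr ⟨hij, h'⟩)⟩
      · rintro ⟨-, (⟨k, s, t, h, h1, h2⟩ | h) | (⟨k, s, t, h, h1, h2⟩ | h)⟩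
        · cases h1; cases h2; exact absurd rfl hij
        · rw [if_pos h.2]; exact one_ne_zero
        · cases h1; cases h2; exact absurd rfl hij
        · rw [if_pos ⟨h.2.1.symm, h.2.2.2, h.2.2.1⟩]; exact one_ne_zero
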